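/- Let k ≥ 2, q = 2^k, and suppose r = 2^k − 1 is prime (a Mersenne prime). Then the set of integer group determinants of GA(1,2^k) is exactly the set of integers of the form A·B^(q−1) where A and B are integers, either r does not divide A or r^2 divides A, and B ≡ A (mod q). -/

import Mathlib

/-- The group determinant of a family of integers indexed by a finite group `G`:
`det (a (g * h⁻¹))`. -/
noncomputable def groupDet (G : Type*) [Group G] [Finite G] (a : G → ℤ) : ℤ :=
  letI : Fintype G := Fintype.ofFinite G
  letI : DecidableEq G := Classical.decEq G
  Matrix.det (Matrix.of fun g h : G => a (g * h⁻¹))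

/-- `D` is an integer group determinant of the finite group `G`. -/
def IsIntGroupDet (G : Type*) [Group G] [Finite G] (D : ℤ) : Prop :=
  ∃ a : G → ℤ, groupDet G a = D

/-- `D` is a `ℤ_m` integer group determinant: a determinant of an integer circulant
matrix `(a_{(i-j) mod m})`. -/
def IsCirculantDet (m : ℕ) (D : ℤ) : Prop :=
  ∃ a : Fin m → ℤ, (Matrix.circulant a).det = D

/-- The action of `F_q^×` on the additive group of `F_q` by multiplication, as a
homomorphism to the automorphism group of `Multiplicative F_q`. -/
noncomputable def GAaction (p k : ℕ) [Fact p.Prime] :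
    (GaloisField p k)ˣ →* MulAut (Multiplicative (GaloisField p k)) where
  toFun u :=
    { toFun := fun x => Multiplicative.ofAdd (u • x.toAdd)
      invFun := fun x => Multiplicative.ofAdd (u⁻¹ • x.toAdd)
      left_inv := fun x => by simp
      right_inv := fun x => by simp
      map_mul' := fun x y => by
        simp [toAdd_mul, smul_add, ofAdd_add] }
  map_one' := by
    ext x
    simp
  map_mul' u v := by
    ext x
    simp [mul_smul]

instance {N G : Type*} [Group N] [Group G] {φ : G →* MulAut N} [Finite N] [Finite G] :
    Finite (N ⋊[φ] G) :=
  Finite.of_equiv (N × G)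
    ⟨fun x => ⟨x.1, x.2⟩, fun x => (x.left, x.right), fun _ => rfl, fun _ => rfl⟩

/-- `GA(1,q)` for `q = p^k`: the semidirect product `F_q ⋊ F_q^×`. -/
abbrev GA1 (p k : ℕ) [Fact p.Prime] :=
  Multiplicative (GaloisField p k) ⋊[GAaction p k] (GaloisField p k)ˣ

open Matrix

theorem det_smul_one_add_vecMulVec {ι R : Type*} [Fintype ι] [DecidableEq ι] [Nonempty ι]
    [CommRing R] (c : R) (u v : ι → R) :
    (c • (1 : Matrix ι ι R) + vecMulVec u v).det
      = c ^ (Fintype.card ι - 1) * (c + u ⬝ᵥ v) := by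
  have h := congrArg (Polynomial.eval c) (charpoly_vecMulVec (-u) v)
  rw [eval_charpoly] at h
  have h1 : scalar ι c - vecMulVec (-u) v = c • (1 : Matrix ι ι R) + vecMulVec u v := by
    rw [neg_vecMulVec, sub_neg_eq_add, scalar_apply, ← smul_one_eq_diagonal]
  rw [h1] at h
  rw [h]
  obtain ⟨m, hm⟩ : ∃ m, Fintype.card ι = m + 1 := Nat.exists_eq_add_one.2 Fintype.card_pos
  simp [hm, pow_succ]
  ring

theorem det_add_smul_vecMulVec_of_vecMul {ι R : Type*} [Fintype ι] [DecidableEq ι] [Nonempty ι]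
    [CommRing R] [IsDomain R] (F : Matrix ι ι R) (hF : F.det ≠ 0) (u v w : ι → R)
    (hw : w ᵥ* F = F.det • v) (hu : u ⬝ᵥ w = 1) (s : R) :
    (F + s • vecMulVec u v).det = F.det + s := by
  have h : F.det • (F + s • vecMulVec u v)
      = (F.det • (1 : Matrix ι ι R) + vecMulVec (s • u) w) * F := by
    rw [add_mul, vecMulVec_mul, hw, smul_mul_assoc, one_mul, smul_add, smul_vecMulVec,
      vecMulVec_smul]
    rw [smul_comm]
  have h2 := congrArg det h
  rw [det_smul, det_mul, det_smul_one_add_vecMulVec, smul_dotProduct, hu] at h2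
  obtain ⟨m, hm⟩ : ∃ m, Fintype.card ι = m + 1 := Nat.exists_eq_add_one.2 Fintype.card_pos
  rw [hm] at h2
  apply mul_left_cancel₀ (pow_ne_zero (m + 1) hF)
  rw [h2]
  simp [pow_succ]
  ring

theorem det_circulant_one_sub_shift (n : ℕ) (y : ℤ) :
    (circulant fun i : ZMod (n + 1) =>
      (if i = 0 then 1 else 0) - (if i = 1 then 1 else 0) + y).det = (n + 1) ^ 2 * y := by
  let C : Matrix (Fin (n + 1)) (Fin (n + 1)) ℤ := of fun i j =>
    (if i = j then 1 else 0) - (if j = Fin.last n then 1 else 0) + y * ((i : ℕ) + 1)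
  have h1 : C.det = (circulant fun i : Fin (n + 1) =>
      (if i = 0 then 1 else 0) - (if i = 1 then 1 else 0) + y).det := by
    apply det_eq_of_forall_row_eq_smul_add_pred (fun _ => 1)
    · intro j
      have : 0 - j = 1 ↔ j = Fin.last n := by
        rw [sub_eq_iff_eq_add, add_comm 1 j, ← Fin.last_add_one, add_left_inj, eq_comm]
      simp only [C, circulant_apply, of_apply, sub_eq_zero, this]
      simp
    · intro i j
      have h2 : i.succ - j = 1 ↔ i.castSucc = j := by
        rw [sub_eq_iff_eq_add, ← Fin.coeSucc_eq_succ, add_comm 1 j, add_left_inj]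
      simp only [C, circulant_apply, of_apply, sub_eq_zero, h2]
      simp
      ring
  let P : Matrix (Fin (n + 1)) (Fin 2) ℤ := of fun i => ![1, y * ((i : ℕ) + 1)]
  let Q : Matrix (Fin 2) (Fin (n + 1)) ℤ :=
    of ![fun j => if j = Fin.last n then -1 else 0, fun _ => 1]
  have h3 : C = 1 + P * Q := by
    ext i j
    simp [C, P, Q, mul_apply, one_apply, Fin.sum_univ_two]
    split_ifs <;> ring
  have h4 : C.det = (n + 1) ^ 2 * y := by
    have h5 : Q * P = !![-1, -(y * (n + 1)); n + 1, ∑ i : Fin (n + 1), y * ((i : ℕ) + 1)] := by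
      ext a b
      fin_cases a <;> fin_cases b <;> simp [P, Q, mul_apply]
    rw [h3, det_one_add_mul_comm, h5, det_fin_two]
    simp
    ring
  exact h1.symm.trans h4

theorem ZMod.val_add_one_eq_ite {n : ℕ} [NeZero n] (j : ZMod n) :
    (j + 1).val = if j = -1 then 0 else j.val + 1 := by
  split_ifs with h
  · simp [h]
  · have hlt : j.val + 1 < n := by
      refine lt_of_le_of_ne (ZMod.val_lt j) fun hn => h ?_
      rw [eq_neg_iff_add_eq_zero, ← ZMod.natCast_zmod_val j]
      exact_mod_cast (congrArg (Nat.cast (R := ZMod n)) hn).trans (ZMod.natCast_self n)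
    rw [← ZMod.val_natCast_of_lt hlt, Nat.cast_add, ZMod.natCast_zmod_val, Nat.cast_one]

theorem ZMod.sum_comp_val {n : ℕ} [NeZero n] {M : Type*} [AddCommMonoid M] (f : ℕ → M) :
    ∑ i : ZMod n, f i.val = ∑ i ∈ Finset.range n, f i := by
  obtain ⟨m, rfl⟩ := Nat.exists_eq_succ_of_ne_zero (NeZero.ne n)
  exact Fin.sum_univ_eq_sum_range f (m + 1)

theorem det_circulant_one_sub_single {r : ℕ} [Fact r.Prime] {a : ZMod r} (ha : a ≠ 0)
    (y : ℤ) : (circulant fun i : ZMod r =>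
      (if i = 0 then 1 else 0) - (if i = a then 1 else 0) + y).det = (r : ℤ) ^ 2 * y := by
  have h : (circulant fun i : ZMod r =>
      (if i = 0 then 1 else 0) - (if i = 1 then 1 else 0) + y).det = (r : ℤ) ^ 2 * y := by
    obtain ⟨n, rfl⟩ := Nat.exists_eq_succ_of_ne_zero (Fact.out : r.Prime).ne_zero
    simpa using det_circulant_one_sub_shift n y
  rw [← h, ← det_submatrix_equiv_self (Equiv.mulLeft₀ a ha)]
  congr 1
  ext i j
  have h1 : a * i - a * j = a ↔ i - j = 1 := by rw [← mul_sub, mul_eq_left₀ ha]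
  have h2 : a * i - a * j = 0 ↔ i - j = 0 := by rw [← mul_sub, mul_eq_zero_iff_left ha]
  simp [circulant_apply, h1, h2]

theorem exists_circulant_det_of_not_dvd {r : ℕ} [Fact r.Prime] {A : ℤ} (h : ¬(r : ℤ) ∣ A) :
    ∃ f : ZMod r → ℤ, (circulant f).det = A ∧ ∑ i, f i = A := by
  have hr0 : (r : ℤ) ≠ 0 := by exact_mod_cast (Fact.out : r.Prime).ne_zero
  have hA : (A : ZMod r) ≠ 0 := by rwa [Ne, ZMod.intCast_zmod_eq_zero_iff_dvd]
  set a : ZMod r := (A : ZMod r) with ha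
  obtain ⟨m, hm⟩ : (r : ℤ) ∣ A - a.val := by
    rw [← ZMod.intCast_zmod_eq_zero_iff_dvd]
    simp [ha]
  let f : ZMod r → ℤ := fun i => (if i.val < a.val then 1 else 0) + m
  have hsum : ∑ i, f i = A := by
    have h1 : {x ∈ Finset.range r | x < a.val} = Finset.range a.val := by
      ext x
      have := ZMod.val_lt a
      simp only [Finset.mem_filter, Finset.mem_range]
      omega
    rw [ZMod.sum_comp_val fun i => (if i < a.val then 1 else 0) + m, Finset.sum_add_distrib,
      Finset.sum_boole, h1]
    simp [-ZMod.natCast_val]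
    linarith
  refine ⟨f, ?_, hsum⟩
  have key : (circulant fun i : ZMod r =>
      (if i = 0 then 1 else 0) - (if i = 1 then 1 else 0) + (1 : ℤ)) * circulant f
      = circulant fun i : ZMod r => (if i = 0 then 1 else 0) - (if i = a then 1 else 0) + A := by
    rw [circulant_mul]
    congr 1
    ext i
    obtain ⟨j, rfl⟩ : ∃ j, i = j + 1 := ⟨i - 1, by simp⟩
    have h1 : ∀ x : ZMod r, j + 1 - x = 1 ↔ j = x := by
      intro x
      rw [sub_eq_iff_eq_add, add_comm 1 x, add_left_inj]
    simp only [mulVec, dotProduct, circulant_apply, add_mul, sub_mul, ite_mul, one_mul, zero_mul,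
      Finset.sum_add_distrib, Finset.sum_sub_distrib, h1, sub_eq_zero (a := j + 1), hsum]
    simp only [Finset.sum_ite_eq, Finset.mem_univ, if_true]
    have h2 : a.val ≠ 0 := by rwa [Ne, ZMod.val_eq_zero]
    have h3 : j + 1 = 0 ↔ j = -1 := eq_neg_iff_add_eq_zero.symm
    have h4 : j + 1 = a ↔ (j + 1).val = a.val := (ZMod.val_injective r).eq_iff.symm
    have h5 : (-1 : ZMod r).val = r - 1 := by
      obtain ⟨n, rfl⟩ := Nat.exists_eq_succ_of_ne_zero (Fact.out : r.Prime).ne_zero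
      exact ZMod.val_neg_one n
    have h6 := ZMod.val_lt a
    simp only [f, h3, h4, ZMod.val_add_one_eq_ite]
    by_cases hj : j = -1
    · subst hj
      simp only [if_true, h5]
      split_ifs <;> omega
    · simp only [hj, if_false]
      split_ifs <;> omega
  have h2 := congrArg det key
  rw [det_mul, det_circulant_one_sub_single one_ne_zero, det_circulant_one_sub_single hA,
    mul_one] at h2
  exact mul_left_cancel₀ (pow_ne_zero 2 hr0) h2

theorem exists_circulant_det_add_of_sq_dvd {r h : ℕ} [Fact r.Prime] (hr : r = 2 * h + 1) {A : ℤ}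
    (hA : A ≠ 0) (hd : (r : ℤ) ^ 2 ∣ A) :
    ∃ f u v : ZMod r → ℤ, ∀ s, (circulant f + s • vecMulVec u v).det = A + s := by
  obtain ⟨m, rfl⟩ := hd
  let f : ZMod r → ℤ := fun i => (if i = 0 then 1 else 0) - (if i = 1 then 1 else 0) + m
  have hf : (circulant f).det = r ^ 2 * m := det_circulant_one_sub_single one_ne_zero m
  let w : ZMod r → ℤ := fun i => r * m * ((i.val : ℤ) - h) + 1
  have hsum : ∑ i, w i = r := by
    have h1 : ∀ N : ℕ, 2 * ∑ i ∈ Finset.range N, (i : ℤ) = N * (N - 1) := by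
      intro N
      induction N with
      | zero => simp
      | succ N ih => rw [Finset.sum_range_succ, mul_add, ih]; push_cast; ring
    have h2 : ∑ i : ZMod r, (i.val : ℤ) = r * h := by
      rw [ZMod.sum_comp_val (fun i => (i : ℤ))]
      have := h1 r
      have h3 : (r : ℤ) - 1 = 2 * h := by rw [hr]; push_cast; ring
      rw [h3] at this
      linarith
    simp only [w, Finset.sum_add_distrib, ← Finset.mul_sum, Finset.sum_sub_distrib, h2]
    simp [ZMod.card]
  refine ⟨f, Pi.single (h : ZMod r) 1, Pi.single (-1) 1, fun s => ?_⟩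
  rw [← hf]
  refine det_add_smul_vecMulVec_of_vecMul _ (hf ▸ hA) _ _ w ?_ ?_ s
  · ext j
    have h1 : ∀ i : ZMod r, i - j = 1 ↔ i = j + 1 := by
      intro i
      rw [sub_eq_iff_eq_add, add_comm 1 j]
    rw [hf]
    simp only [vecMul, dotProduct, circulant_apply, f, mul_add, mul_sub, mul_ite, mul_one, mul_zero,
      Finset.sum_add_distrib, Finset.sum_sub_distrib, h1, sub_eq_zero, ← Finset.sum_mul, hsum]
    simp only [Finset.sum_ite_eq', Finset.mem_univ, if_true, w, ZMod.val_add_one_eq_ite]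
    by_cases hj : j = -1
    · have h5 : ((-1 : ZMod r).val : ℤ) = r - 1 := by
        obtain ⟨n, rfl⟩ := Nat.exists_eq_succ_of_ne_zero (Fact.out : r.Prime).ne_zero
        rw [ZMod.val_neg_one]
        simp
      subst hj
      simp only [if_true, h5]
      simp
      ring
    · simp [hj]
      ring
  · have : (h : ZMod r).val = h := ZMod.val_natCast_of_lt (by omega)
    rw [single_one_dotProduct]
    simp only [w, this]
    simp

theorem exists_circulant_det_add {r : ℕ} [Fact r.Prime] (hr : Odd r) {A : ℤ}
    (hA : A ≠ 0) (hd : ¬(r : ℤ) ∣ A ∨ (r : ℤ) ^ 2 ∣ A) :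
    ∃ f u v : ZMod r → ℤ, ∀ s, (circulant f + s • vecMulVec u v).det = A + s := by
  rcases hd with hd | hd
  · obtain ⟨f, hf, hsum⟩ := exists_circulant_det_of_not_dvd hd
    refine ⟨f, Pi.single 0 1, 1, fun s => ?_⟩
    rw [← hf]
    refine det_add_smul_vecMulVec_of_vecMul _ (hf ▸ hA) _ _ 1 ?_ (by simp) s
    ext j
    rw [hf, ← hsum]
    simp only [vecMul, dotProduct, circulant_apply, Pi.one_apply, one_mul, Pi.smul_apply,
      smul_eq_mul, mul_one]
    exact (Equiv.subRight j).sum_comp f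
  · obtain ⟨h, hh⟩ := hr
    exact exists_circulant_det_add_of_sq_dvd hh hA hd

/-- The homomorphism from the group algebra of a finite additive abelian group to matrices
given by the regular representation. -/
noncomputable def circulantHom (R G : Type*) [CommRing R] [AddCommGroup G] [Fintype G]
    [DecidableEq G] : AddMonoidAlgebra R G →+* Matrix G G R :=
  (Algebra.leftMulMatrix (AddMonoidAlgebra.basis G R)).toRingHom

theorem circulantHom_apply {R G : Type*} [CommRing R] [AddCommGroup G] [Fintype G]
    [DecidableEq G] (x : AddMonoidAlgebra R G) :
    circulantHom R G x = circulant x.coeff := by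
  ext i j
  change Algebra.leftMulMatrix (AddMonoidAlgebra.basis G R) x i j = _
  rw [Algebra.leftMulMatrix_eq_repr_mul, AddMonoidAlgebra.basis_apply]
  change (x * AddMonoidAlgebra.single j 1).coeff i = _
  simp [circulant_apply, sub_eq_add_neg]

theorem AddMonoidAlgebra.pow_card_zmod {r : ℕ} [Fact r.Prime]
    (x : AddMonoidAlgebra (ZMod r) (ZMod r)) :
    x ^ r = AddMonoidAlgebra.single 0 (∑ i, x.coeff i) := by
  have : CharP (AddMonoidAlgebra (ZMod r) (ZMod r)) r :=
    charP_of_injective_algebraMap (R := ZMod r) (FaithfulSMul.algebraMap_injective _ _) r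
  have h : x = ∑ i, AddMonoidAlgebra.single i (x.coeff i) := by
    ext j
    simp [AddMonoidAlgebra.coeff_sum]
  conv_lhs => rw [h, sum_pow_char]
  simp only [AddMonoidAlgebra.single_pow, ZMod.pow_card, CharP.cast_eq_zero, nsmul_eq_mul, zero_mul]
  exact (map_sum (AddMonoidAlgebra.singleAddHom 0) _ _).symm

theorem dvd_sum_of_dvd_det_circulant {r : ℕ} [Fact r.Prime] (f : ZMod r → ℤ)
    (h : (r : ℤ) ∣ (circulant f).det) : (r : ℤ) ∣ ∑ i, f i := by
  rw [← ZMod.intCast_zmod_eq_zero_iff_dvd] at h ⊢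
  let x : AddMonoidAlgebra (ZMod r) (ZMod r) :=
    .ofCoeff (Finsupp.equivFunOnFinite.symm fun i => (f i : ZMod r))
  have h1 : (((circulant f).det : ℤ) : ZMod r) = (circulantHom (ZMod r) (ZMod r) x).det := by
    rw [Int.cast_det, circulantHom_apply]
    rfl
  have h2 : (circulantHom (ZMod r) (ZMod r) x) ^ r = (∑ i, (f i : ZMod r)) • 1 := by
    rw [← map_pow, AddMonoidAlgebra.pow_card_zmod, circulantHom_apply]
    ext i j
    rw [circulant_apply, Matrix.smul_apply, one_apply]
    simp [x, Finsupp.single_apply, sub_eq_zero, eq_comm]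
  have h3 := congrArg det h2
  rw [det_pow, ← h1, h, det_smul, det_one, mul_one, zero_pow (NeZero.ne r), ZMod.card,
    ZMod.pow_card] at h3
  rw [Int.cast_sum, ← h3]

theorem not_dvd_or_sq_dvd_det_circulant {r : ℕ} [Fact r.Prime] (f : ZMod r → ℤ) :
    ¬(r : ℤ) ∣ (circulant f).det ∨ (r : ℤ) ^ 2 ∣ (circulant f).det := by
  by_contra! hcon
  obtain ⟨hd, hn⟩ := hcon
  apply hn
  have hs := dvd_sum_of_dvd_det_circulant f hd
  set S := ∑ i, f i with hS
  let F' : Matrix (ZMod r) (ZMod r) ℤ := updateRow (circulant f) 0 1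
  have h1 : (circulant f).det = S * F'.det := by
    have h2 : ∑ i : ZMod r, (1 : ℤ) • (circulant f) i = S • (1 : ZMod r → ℤ) := by
      ext j
      simp only [one_smul, Pi.smul_apply, Pi.one_apply, smul_eq_mul, mul_one, hS]
      refine (Finset.sum_apply j _ _).trans ?_
      exact (Equiv.subRight j).sum_comp f
    have h3 := det_updateRow_sum (circulant f) 0 (fun _ => (1 : ℤ))
    rw [h2, det_updateRow_smul] at h3
    simpa using h3.symm
  have h4 : (r : ℤ) ∣ F'.det := by
    have h5 : (r : ℤ) ∣ F'.det * 1 := by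
      have h6 : (F'.adjugate * F') *ᵥ 1 = F'.det • (1 : ZMod r → ℤ) := by
        rw [adjugate_mul, smul_mulVec, one_mulVec]
      have h7 : F'.det * 1 = ∑ i, F'.adjugate 0 i * (F' *ᵥ 1) i := by
        have := congrFun h6 0
        rw [← mulVec_mulVec] at this
        exact this.symm
      rw [h7]
      refine Finset.dvd_sum fun i _ => Dvd.dvd.mul_left ?_ _
      by_cases hi : i = 0
      · subst hi
        simp [F', mulVec, dotProduct, ZMod.card]
      · have : (F' *ᵥ 1) i = S := by
          simp only [F', mulVec, dotProduct, updateRow_ne hi, circulant_apply, Pi.one_apply,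
            mul_one, hS]
          exact (Equiv.subLeft i).sum_comp f
        rwa [this]
    rwa [mul_one] at h5
  rw [h1, pow_two]
  exact mul_dvd_mul hs h4

section Affine

variable {K : Type*} [Field K] [Fintype K]

/-- The integer linear extension to the group algebra of an additive character. -/
noncomputable def charHom (ψ : AddChar K ℤ) : AddMonoidAlgebra ℤ K →+* ℤ :=
  (AddMonoidAlgebra.lift ℤ ℤ K ψ.toMonoidHom).toRingHom

theorem charHom_apply (ψ : AddChar K ℤ) (x : AddMonoidAlgebra ℤ K) :
    charHom ψ x = ∑ z, x.coeff z * ψ z := by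
  change AddMonoidAlgebra.lift ℤ ℤ K ψ.toMonoidHom x = _
  rw [AddMonoidAlgebra.lift_apply, Finsupp.sum_fintype _ _ (by simp)]
  rfl

/-- Left multiplication by an element of `ℤ[K ⋊ Kˣ]`, as a matrix over `ℤ[K]`. -/
noncomputable def affineMatrix (a : K → Kˣ → ℤ) : Matrix Kˣ Kˣ (AddMonoidAlgebra ℤ K) :=
  of fun u v => .ofCoeff (Finsupp.equivFunOnFinite.symm fun z => a (u * z) (u * v⁻¹))

theorem affineMatrix_coeff (a : K → Kˣ → ℤ) (u v : Kˣ) (z : K) :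
    (affineMatrix a u v).coeff z = a (u * z) (u * v⁻¹) := rfl

theorem charHom_affineMatrix (a : K → Kˣ → ℤ) (ψ : AddChar K ℤ) (u v : Kˣ) :
    charHom ψ (affineMatrix a u v) = ∑ z, a (u * z) (u * v⁻¹) * ψ z :=
  charHom_apply _ _

theorem charHom_one_affineMatrix (a : K → Kˣ → ℤ) (u v : Kˣ) :
    charHom 1 (affineMatrix a u v) = ∑ x, a x (u * v⁻¹) := by
  rw [charHom_affineMatrix]
  simp only [AddChar.one_apply, mul_one]
  exact Equiv.sum_comp (Equiv.mulLeft₀ (u : K) u.ne_zero) fun x => a x (u * v⁻¹)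

variable [DecidableEq K]

theorem affineMatrix_det_coeff_mul (a : K → Kˣ → ℤ) (w : Kˣ) (z : K) :
    (affineMatrix a).det.coeff (w * z) = (affineMatrix a).det.coeff z := by
  let φ : AddMonoidAlgebra ℤ K →+* AddMonoidAlgebra ℤ K :=
    AddMonoidAlgebra.mapDomainRingHom ℤ (AddMonoidHom.mulLeft (w : K))
  have hφ : ∀ (x : AddMonoidAlgebra ℤ K) (z : K), (φ x).coeff (w * z) = x.coeff z := fun x z =>
    Finsupp.mapDomain_apply (mul_right_injective₀ w.ne_zero) x.coeff z
  have h : φ.mapMatrix (affineMatrix a)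
      = (affineMatrix a).submatrix (Equiv.mulRight w⁻¹) (Equiv.mulRight w⁻¹) := by
    ext u v y
    obtain ⟨z, rfl⟩ : ∃ z, y = w * z := ⟨w⁻¹ * y, by simp⟩
    simp [hφ, affineMatrix_coeff, mul_assoc]
  have h1 : φ (affineMatrix a).det = (affineMatrix a).det := by
    rw [RingHom.map_det, h, det_submatrix_equiv_self]
  rw [← hφ _ z, h1]

theorem affineMatrix_det_coeff (a : K → Kˣ → ℤ) {z : K} (hz : z ≠ 0) :
    (affineMatrix a).det.coeff z = (affineMatrix a).det.coeff 1 := by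
  simpa using affineMatrix_det_coeff_mul a (Units.mk0 z hz) 1

theorem charHom_affineMatrix_det (a : K → Kˣ → ℤ) (ψ : AddChar K ℤ) :
    charHom ψ (affineMatrix a).det
      = (affineMatrix a).det.coeff 0 - (affineMatrix a).det.coeff 1
        + (affineMatrix a).det.coeff 1 * ∑ z, ψ z := by
  have h : ∀ z : K, (affineMatrix a).det.coeff z * ψ z
      = (if z = 0 then (affineMatrix a).det.coeff 0 - (affineMatrix a).det.coeff 1 else 0)
        + (affineMatrix a).det.coeff 1 * ψ z := by
    intro z
    split_ifs with hz
    · subst hz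
      rw [AddChar.map_zero_eq_one]
      ring
    · rw [affineMatrix_det_coeff a hz, zero_add]
  rw [charHom_apply, Finset.sum_congr rfl fun z _ => h z, Finset.sum_add_distrib,
    ← Finset.mul_sum]
  simp

theorem det_circulantHom_affineMatrix_det (a : K → Kˣ → ℤ) :
    (circulantHom ℤ K (affineMatrix a).det).det
      = charHom 1 (affineMatrix a).det
        * ((affineMatrix a).det.coeff 0 - (affineMatrix a).det.coeff 1)
          ^ (Fintype.card K - 1) := by
  set c := (affineMatrix a).det.coeff 1 with hc
  have h : circulantHom ℤ K (affineMatrix a).det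
      = ((affineMatrix a).det.coeff 0 - c) • (1 : Matrix K K ℤ) + vecMulVec (fun _ => c) 1 := by
    rw [circulantHom_apply]
    ext i j
    rw [circulant_apply, Matrix.add_apply, Matrix.smul_apply, one_apply, vecMulVec_apply]
    split_ifs with hij
    · simp [hij]
    · rw [affineMatrix_det_coeff a (sub_ne_zero.2 hij)]
      simp [hc]
  rw [h, det_smul_one_add_vecMulVec, charHom_affineMatrix_det, ← hc, mul_comm]
  simp [dotProduct, mul_comm]

theorem exists_affineMatrix_of_charTwo [CharP K 2] {ψ : AddChar K ℤ} (hψ : ψ ≠ 1)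
    (f : Kˣ → ℤ) (X : Kˣ → Kˣ → ℤ) :
    ∃ a : K → Kˣ → ℤ, ∀ u v : Kˣ, charHom 1 (affineMatrix a u v) = f (u * v⁻¹) ∧
      charHom ψ (affineMatrix a u v) = f (u * v⁻¹) + Fintype.card K * X u v := by
  have hprim := AddChar.IsPrimitive.of_ne_one hψ
  let a : K → Kˣ → ℤ := fun x s =>
    (if x = 0 then f s else 0) + ∑ u : Kˣ, X u (s⁻¹ * u) * ψ ((u⁻¹ : Kˣ) * x)
  refine ⟨a, fun u v => ⟨?_, ?_⟩⟩
  · have h : ∀ w : Kˣ, ∑ x : K, ψ ((w⁻¹ : Kˣ) * x) = 0 := by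
      intro w
      simp_rw [mul_comm _ (_ : K)]
      simpa using AddChar.sum_mulShift ((w⁻¹ : Kˣ) : K) hprim
    rw [charHom_one_affineMatrix]
    simp only [a, Finset.sum_add_distrib]
    rw [Finset.sum_comm]
    simp_rw [← Finset.mul_sum, h]
    simp
  · have h : ∀ w : Kˣ, ∑ z : K, ψ ((w⁻¹ : Kˣ) * (u * z)) * ψ z
        = if w = u then (Fintype.card K : ℤ) else 0 := by
      intro w
      have h1 : ∀ z : K, ψ ((w⁻¹ : Kˣ) * (u * z)) * ψ z = ψ (z * ((w⁻¹ : Kˣ) * u + 1)) := by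
        intro z
        rw [← AddChar.map_add_eq_mul]
        congr 1
        ring
      have h2 : ((w⁻¹ : Kˣ) : K) * u + 1 = 0 ↔ w = u := by
        rw [CharTwo.add_eq_zero, ← Units.val_mul, Units.val_eq_one, inv_mul_eq_one]
      rw [Finset.sum_congr rfl fun z _ => h1 z, AddChar.sum_mulShift _ hprim]
      simp only [h2]
      push_cast
      rfl
    rw [charHom_affineMatrix]
    simp only [a, add_mul, Finset.sum_add_distrib, Finset.sum_mul]
    rw [Finset.sum_comm]
    simp_rw [mul_assoc, ← Finset.mul_sum, h]
    simp [mul_comm]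

end Affine

theorem groupDet_GA1 (k : ℕ) [Fintype (GaloisField 2 k)] [DecidableEq (GaloisField 2 k)]
    (a : GA1 2 k → ℤ) :
    groupDet (GA1 2 k) a = (circulantHom ℤ (GaloisField 2 k)
      (affineMatrix fun x s => a ⟨Multiplicative.ofAdd x, s⟩).det).det := by
  rw [det_det]
  let e : (GaloisField 2 k)ˣ × GaloisField 2 k ≃ GA1 2 k :=
    { toFun := fun p => ⟨Multiplicative.ofAdd (p.1 * p.2), p.1⟩
      invFun := fun g => (g.right, ((g.right⁻¹ : (GaloisField 2 k)ˣ) : GaloisField 2 k)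
        * g.left.toAdd)
      left_inv := fun p => by simp
      right_inv := fun g => by ext <;> simp }
  unfold groupDet
  let _ : Fintype (GA1 2 k) := Fintype.ofFinite _
  let _ : DecidableEq (GA1 2 k) := Classical.decEq _
  rw [← det_submatrix_equiv_self e]
  congr 1
  ext ⟨u, x⟩ ⟨v, y⟩
  simp only [submatrix_apply, of_apply, comp_apply, map_apply, circulantHom_apply,
    circulant_apply, affineMatrix_coeff]
  congr 1
  ext
  · change (u : GaloisField 2 k) * x + u • (v⁻¹ • -((v : GaloisField 2 k) * y)) = u * (x - y)
    simp [Units.smul_def]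
    ring
  · simp [e]

theorem exists_addChar_int_ne_one (k : ℕ) : ∃ ψ : AddChar (GaloisField 2 k) ℤ, ψ ≠ 1 := by
  obtain ⟨l, hl⟩ : ∃ l : Module.Dual (ZMod 2) (GaloisField 2 k), l 1 ≠ 0 := by
    by_contra! h
    exact one_ne_zero ((Module.forall_dual_apply_eq_zero_iff (ZMod 2) (1 : GaloisField 2 k)).1 h)
  have hl1 : l 1 = 1 := by
    generalize l 1 = t at hl
    revert t
    decide
  refine ⟨(AddChar.zmodChar 2 (show (-1 : ℤ) ^ 2 = 1 by norm_num)).compAddMonoidHom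
    l.toAddMonoidHom, fun h => ?_⟩
  have h1 := DFunLike.congr_fun h 1
  simp [AddChar.zmodChar_apply, hl1] at h1
  exact absurd h1 (by decide)

theorem exists_equiv_zmod_of_isCyclic {G : Type*} [Group G] [IsCyclic G] {n : ℕ}
    (hn : Nat.card G = n) : ∃ e : G ≃ ZMod n, ∀ u v, e (u * v⁻¹) = e u - e v := by
  obtain ⟨g, hg⟩ := IsCyclic.exists_generator (α := G)
  let e := (zmodMulEquivOfGenerator hg hn).symm
  exact ⟨e.toEquiv.trans Multiplicative.toAdd, fun u v => by simp [e, sub_eq_add_neg]⟩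

/-- When `r = 2^k - 1` is a Mersenne prime, the integer group determinants of
`GA(1,2^k)` are exactly the `A * B^(q-1)` with `r ∤ A` or `r² ∣ A`, and `B ≡ A (mod q)`. -/
theorem stmt3 (k q r : ℕ) (hk : 2 ≤ k) (hq : q = 2 ^ k) (hr : r = 2 ^ k - 1)
    (hrp : Nat.Prime r) (D : ℤ) :
    IsIntGroupDet (GA1 2 k) D ↔
      ∃ A B : ℤ, (¬ (r : ℤ) ∣ A ∨ (r : ℤ) ^ 2 ∣ A) ∧ B ≡ A [ZMOD (q : ℤ)] ∧
        D = A * B ^ (q - 1) := by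
  classical
  have : Fact r.Prime := ⟨hrp⟩
  let _ : Fintype (GaloisField 2 k) := Fintype.ofFinite _
  have hcard : Fintype.card (GaloisField 2 k) = q := by
    rw [← Nat.card_eq_fintype_card, GaloisField.card 2 k (by omega), hq]
  have hr_card : Nat.card (GaloisField 2 k)ˣ = r := by
    rw [Nat.card_eq_fintype_card, Fintype.card_units, hcard, hq, hr]
  have hodd : Odd r := by
    rw [hr]
    exact Nat.Even.sub_odd Nat.one_le_two_pow (Nat.even_pow.2 ⟨even_two, by omega⟩) odd_one
  obtain ⟨e, he⟩ := exists_equiv_zmod_of_isCyclic hr_card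
  constructor
  · rintro ⟨a, rfl⟩
    let b : GaloisField 2 k → (GaloisField 2 k)ˣ → ℤ := fun x s => a ⟨Multiplicative.ofAdd x, s⟩
    let f : ZMod r → ℤ := fun i => ∑ x, b x (e.symm i)
    have hA : charHom 1 (affineMatrix b).det = (circulant f).det := by
      rw [RingHom.map_det, ← det_submatrix_equiv_self e (circulant f)]
      congr 1
      ext u v
      simp only [RingHom.mapMatrix_apply, map_apply, charHom_one_affineMatrix, submatrix_apply,
        circulant_apply, ← he, f, Equiv.symm_apply_apply]
    refine ⟨charHom 1 (affineMatrix b).det,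
      (affineMatrix b).det.coeff 0 - (affineMatrix b).det.coeff 1, ?_, ?_, ?_⟩
    · rw [hA]
      exact not_dvd_or_sq_dvd_det_circulant f
    · rw [charHom_affineMatrix_det, Int.modEq_iff_dvd]
      simp [hcard]
    · rw [groupDet_GA1, det_circulantHom_affineMatrix_det, hcard]
  · rintro ⟨A, B, hA, hAB, rfl⟩
    by_cases hA0 : A = 0
    · refine ⟨0, ?_⟩
      rw [hA0, zero_mul]
      exact @det_zero _ (Classical.decEq _) (Fintype.ofFinite _) _ _ _
    · obtain ⟨f, U, V, hf⟩ := exists_circulant_det_add hodd hA0 hA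
      obtain ⟨t, ht⟩ := (Int.modEq_iff_dvd.1 hAB.symm)
      obtain ⟨ψ, hψ⟩ := exists_addChar_int_ne_one k
      obtain ⟨b, hb⟩ := exists_affineMatrix_of_charTwo hψ (fun s => f (e s))
        (fun u v => t * (U (e u) * V (e v)))
      have h1 : charHom 1 (affineMatrix b).det = A := by
        have h0 := hf 0
        rw [zero_smul, add_zero, add_zero] at h0
        rw [RingHom.map_det, ← h0, ← det_submatrix_equiv_self e (circulant f)]
        congr 1
        ext u v
        simp [(hb u v).1, circulant_apply, he]
      have h2 : charHom ψ (affineMatrix b).det = B := by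
        have h0 := hf (q * t)
        rw [show A + q * t = B by rw [← ht]; ring] at h0
        rw [RingHom.map_det, ← h0, ← det_submatrix_equiv_self e]
        congr 1
        ext u v
        rw [RingHom.mapMatrix_apply, map_apply, (hb u v).2, submatrix_apply, Matrix.add_apply,
          Matrix.smul_apply, vecMulVec_apply, circulant_apply, he, hcard, smul_eq_mul, mul_assoc]
      have h3 := charHom_affineMatrix_det b ψ
      rw [AddChar.sum_eq_zero_of_ne_one hψ, mul_zero, add_zero, h2] at h3
      refine ⟨fun g => b g.left.toAdd g.right, ?_⟩
      rw [groupDet_GA1, ← hcard]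
      simp only [toAdd_ofAdd]
      rw [det_circulantHom_affineMatrix_det, h1, h3]
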